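/- In the skew-paired Yang–Baxter bialgebras, an element E_{a₁}···E_{a_N} ω^{a₁···a_N} of Y₋ (with numerical coefficients ω) pairs to zero with every element of the form F^{q₁}···F^{q_N}Φ(U) of Y₊ if and only if [N!]_B ω = 0 as a vector in V^{⊗N}. -/

import Mathlib

open TensorProduct Matrix

section YangBaxterAlgebra

variable (k : Type*) [Field k] (ι : Type*) [Fintype ι] [DecidableEq ι]
variable (Rm : Matrix (ι × ι) (ι × ι) k)

/-- `R ⊗ 1` acting on factors 1,2 of the triple tensor product (in components). -/
def M12 : Matrix (ι × ι × ι) (ι × ι × ι) k :=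
  fun a b => Rm (a.1, a.2.1) (b.1, b.2.1) * (if a.2.2 = b.2.2 then 1 else 0)

/-- `1 ⊗ R` acting on factors 2,3 of the triple tensor product (in components). -/
def M23 : Matrix (ι × ι × ι) (ι × ι × ι) k :=
  fun a b => (if a.1 = b.1 then (1 : k) else 0) * Rm (a.2.1, a.2.2) (b.2.1, b.2.2)

/-- `R` acting on factors 1,3 of the triple tensor product (in components). -/
def M13 : Matrix (ι × ι × ι) (ι × ι × ι) k :=
  fun a b => Rm (a.1, a.2.2) (b.1, b.2.2) * (if a.2.1 = b.2.1 then 1 else 0)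

/-- The Yang-Baxter equation `R₁₂R₁₃R₂₃ = R₂₃R₁₃R₁₂` in components. -/
def IsYangBaxter : Prop :=
  M12 k ι Rm * M13 k ι Rm * M23 k ι Rm = M23 k ι Rm * M13 k ι Rm * M12 k ι Rm

/-- Free generators: `Sum.inl (i,j)` is the matrix generator (`t^i_j` resp.
`u^i_j`), `Sum.inr i` is the extra generator (`E_i` resp. `F^i`). -/
abbrev YGen := (ι × ι) ⊕ ι

/-- The free matrix generator. -/
def tGen (i j : ι) : FreeAlgebra k (YGen ι) := FreeAlgebra.ι k (Sum.inl (i, j))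

/-- The free extra generator. -/
def eGen (i : ι) : FreeAlgebra k (YGen ι) := FreeAlgebra.ι k (Sum.inr i)

/-- Defining relations of `Y₋`: `R₁₂T₁T₂ = T₂T₁R₁₂` and `E₁T₂ = T₂E₁R₁₂`,
written in components. -/
inductive relMinus : FreeAlgebra k (YGen ι) → FreeAlgebra k (YGen ι) → Prop
  | rtt (i j m n : ι) : relMinus
      (∑ p : ι, ∑ q : ι, Rm (i, j) (p, q) • (tGen k ι p m * tGen k ι q n))
      (∑ p : ι, ∑ q : ι, Rm (p, q) (m, n) • (tGen k ι j q * tGen k ι i p))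
  | ret (j m n : ι) : relMinus
      (eGen k ι m * tGen k ι j n)
      (∑ p : ι, ∑ q : ι, Rm (p, q) (m, n) • (tGen k ι j q * eGen k ι p))

/-- Defining relations of `Y₊`: `R₁₂U₁U₂ = U₂U₁R₁₂` and `F₂U₁ = R₁₂U₁F₂`,
written in components. -/
inductive relPlus : FreeAlgebra k (YGen ι) → FreeAlgebra k (YGen ι) → Prop
  | ruu (i j m n : ι) : relPlus
      (∑ p : ι, ∑ q : ι, Rm (i, j) (p, q) • (tGen k ι p m * tGen k ι q n))
      (∑ p : ι, ∑ q : ι, Rm (p, q) (m, n) • (tGen k ι j q * tGen k ι i p))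
  | rfu (i j m : ι) : relPlus
      (eGen k ι j * tGen k ι i m)
      (∑ p : ι, ∑ q : ι, Rm (i, j) (p, q) • (tGen k ι p m * eGen k ι q))

/-- The Yang-Baxter bialgebra `Y₋` (generated by `t^i_j`, `E_i`). -/
abbrev Yminus := RingQuot (relMinus k ι Rm)

/-- The Yang-Baxter bialgebra `Y₊` (generated by `u^i_j`, `F^i`). -/
abbrev Yplus := RingQuot (relPlus k ι Rm)

/-- The generator `t^i_j` of `Y₋`. -/
def tM (i j : ι) : Yminus k ι Rm := RingQuot.mkAlgHom k (relMinus k ι Rm) (tGen k ι i j)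

/-- The generator `E_i` of `Y₋`. -/
def eM (i : ι) : Yminus k ι Rm := RingQuot.mkAlgHom k (relMinus k ι Rm) (eGen k ι i)

/-- The generator `u^i_j` of `Y₊`. -/
def uP (i j : ι) : Yplus k ι Rm := RingQuot.mkAlgHom k (relPlus k ι Rm) (tGen k ι i j)

/-- The generator `F^i` of `Y₊`. -/
def fP (i : ι) : Yplus k ι Rm := RingQuot.mkAlgHom k (relPlus k ι Rm) (eGen k ι i)

end YangBaxterAlgebra

/-- The pairing induced on tensor squares by bilinear pairings:
`⟨x ⊗ y, a ⊗ b⟩ = ⟨x, a⟩⟨y, b⟩`. -/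
noncomputable def tensorPairing {k A B : Type*} [CommRing k]
    [AddCommGroup A] [Module k A] [AddCommGroup B] [Module k B]
    (p q : B →ₗ[k] Module.Dual k A) :
    (B ⊗[k] B) →ₗ[k] Module.Dual k (A ⊗[k] A) :=
  TensorProduct.dualDistrib k A A ∘ₗ TensorProduct.map p q

section Pairing

variable {k : Type*} [Field k] {ι : Type*} [Fintype ι] [DecidableEq ι]
variable (Rm : Matrix (ι × ι) (ι × ι) k)

/-- The hypotheses on the skew pairing `⟨·,·⟩ : Y₊ ⊗ Y₋ → k` of the
Yang-Baxter bialgebras: its values on generators `⟨U,T⟩ = R`, `⟨F,E⟩ = 1`,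
`⟨1,T⟩ = ⟨U,1⟩ = 1`, all other pairings of generators zero, and the skew
pairing axioms with respect to the comultiplications `Dp`, `Dm`. -/
structure IsYBPairing
    (p : Yplus k ι Rm →ₗ[k] Module.Dual k (Yminus k ι Rm))
    (Dm : Yminus k ι Rm →ₐ[k] (Yminus k ι Rm ⊗[k] Yminus k ι Rm))
    (Dp : Yplus k ι Rm →ₐ[k] (Yplus k ι Rm ⊗[k] Yplus k ι Rm)) : Prop where
  comul_t : ∀ i j : ι, Dm (tM k ι Rm i j) = ∑ q : ι, tM k ι Rm i q ⊗ₜ[k] tM k ι Rm q j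
  comul_e : ∀ i : ι, Dm (eM k ι Rm i) =
    (∑ q : ι, eM k ι Rm q ⊗ₜ[k] tM k ι Rm q i) + 1 ⊗ₜ[k] eM k ι Rm i
  comul_u : ∀ i j : ι, Dp (uP k ι Rm i j) = ∑ q : ι, uP k ι Rm i q ⊗ₜ[k] uP k ι Rm q j
  comul_f : ∀ i : ι, Dp (fP k ι Rm i) =
    fP k ι Rm i ⊗ₜ[k] 1 + ∑ q : ι, uP k ι Rm i q ⊗ₜ[k] fP k ι Rm q
  pair_ut : ∀ i j m n : ι, p (uP k ι Rm i j) (tM k ι Rm m n) = Rm (i, m) (j, n)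
  pair_fe : ∀ i j : ι, p (fP k ι Rm i) (eM k ι Rm j) = if i = j then 1 else 0
  pair_one_t : ∀ i j : ι, p 1 (tM k ι Rm i j) = if i = j then 1 else 0
  pair_u_one : ∀ i j : ι, p (uP k ι Rm i j) 1 = if i = j then 1 else 0
  pair_one_one : p 1 1 = 1
  pair_f_one : ∀ i : ι, p (fP k ι Rm i) 1 = 0
  pair_one_e : ∀ i : ι, p 1 (eM k ι Rm i) = 0
  pair_ue : ∀ i j m : ι, p (uP k ι Rm i j) (eM k ι Rm m) = 0
  pair_ft : ∀ i m n : ι, p (fP k ι Rm i) (tM k ι Rm m n) = 0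
  skew_mul : ∀ (x y : Yplus k ι Rm) (a : Yminus k ι Rm),
    p (x * y) a = tensorPairing p p (x ⊗ₜ[k] y) (Dm a)
  skew_comul : ∀ (x : Yplus k ι Rm) (a b : Yminus k ι Rm),
    tensorPairing p p (Dp x) (a ⊗ₜ[k] b) = p x (b * a)

end Pairing

section Braided

variable {k : Type*} [Field k] {ι : Type*} [Fintype ι] [DecidableEq ι]

/-- The braid matrix `B` acting on tensor factors `i, i+1` (0-based) of the
`N`-fold tensor power (in components). -/
def Bop (B : Matrix (ι × ι) (ι × ι) k) (N i : ℕ) :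
    Matrix (Fin N → ι) (Fin N → ι) k :=
  if h : i + 1 < N then
    fun f g =>
      B (f ⟨i, Nat.lt_of_succ_lt h⟩, f ⟨i + 1, h⟩)
          (g ⟨i, Nat.lt_of_succ_lt h⟩, g ⟨i + 1, h⟩) *
        ∏ j : Fin N,
          if (j : ℕ) = i ∨ (j : ℕ) = i + 1 then 1 else (if f j = g j then (1 : k) else 0)
  else 1

/-- The descending products `1, B_{N-1}, B_{N-1}B_{N-2}, ...` (here `B_m` is the
braid matrix acting on factors `m, m+1`, 1-based). -/
def chainDesc (B : Matrix (ι × ι) (ι × ι) k) (N : ℕ) :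
    ℕ → Matrix (Fin N → ι) (Fin N → ι) k
  | 0 => 1
  | m + 1 => chainDesc B N m * Bop B N (N - 2 - m)

/-- The braided integer `[N]_B = 1 + B_{N-1} + B_{N-1}B_{N-2} + ⋯ + B_{N-1}⋯B_1`. -/
def braidedInt (B : Matrix (ι × ι) (ι × ι) k) (N : ℕ) :
    Matrix (Fin N → ι) (Fin N → ι) k :=
  ∑ m ∈ Finset.range N, chainDesc B N m

/-- Extension `M ↦ M ⊗ 1` of an operator on the `N`-fold tensor power to the
`(N+1)`-fold tensor power. -/
def extendLast {k : Type*} [Field k] {ι : Type*} [Fintype ι] [DecidableEq ι] {N : ℕ}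
    (M : Matrix (Fin N → ι) (Fin N → ι) k) :
    Matrix (Fin (N + 1) → ι) (Fin (N + 1) → ι) k :=
  fun f g => M (Fin.init f) (Fin.init g) * (if f (Fin.last N) = g (Fin.last N) then 1 else 0)

/-- The braided factorial: `[0!]_B = 1`, `[N!]_B = ([(N-1)!]_B ⊗ 1) [N]_B`. -/
def braidedFactorial (B : Matrix (ι × ι) (ι × ι) k) :
    (N : ℕ) → Matrix (Fin N → ι) (Fin N → ι) k
  | 0 => 1
  | N + 1 => extendLast (braidedFactorial B N) * braidedInt B (N + 1)

end Braided

section BraidedRecursion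

lemma snoc_eq_snoc_iff {ι : Type*} {N : ℕ} (c d : Fin N → ι) (i j : ι) :
    (Fin.snoc c i : Fin (N + 1) → ι) = Fin.snoc d j ↔ c = d ∧ i = j :=
  Fin.snoc_inj

lemma matrix_ext_snoc {k ι : Type*} {N : ℕ} {M M' : Matrix (Fin (N + 1) → ι) (Fin (N + 1) → ι) k}
    (h : ∀ c i d j, M (Fin.snoc c i) (Fin.snoc d j) = M' (Fin.snoc c i) (Fin.snoc d j)) :
    M = M' := by
  ext f g
  rw [← Fin.snoc_init_self f, ← Fin.snoc_init_self g]
  exact h _ _ _ _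

lemma sum_fun_eq_sum_snoc {ι M : Type*} [Fintype ι] [AddCommMonoid M] {N : ℕ}
    (F : (Fin (N + 1) → ι) → M) :
    ∑ a, F a = ∑ c : Fin N → ι, ∑ i : ι, F (Fin.snoc c i) := by
  classical
  rw [← (Fin.snocEquiv fun _ => ι).sum_comp, Fintype.sum_prod_type, Finset.sum_comm]
  rfl

lemma Bop_apply {k ι : Type*} [Field k] [DecidableEq ι] (B : Matrix (ι × ι) (ι × ι) k)
    {N i : ℕ} (h : i + 1 < N) (f g : Fin N → ι) :
    Bop B N i f g = B (f ⟨i, Nat.lt_of_succ_lt h⟩, f ⟨i + 1, h⟩)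
      (g ⟨i, Nat.lt_of_succ_lt h⟩, g ⟨i + 1, h⟩) *
        ∏ j : Fin N,
          if (j : ℕ) = i ∨ (j : ℕ) = i + 1 then 1 else (if f j = g j then (1 : k) else 0) := by
  have := congrFun (congrFun (dif_pos h : Bop B N i = _) f) g
  exact this

/-- The braid matrix on the last two tensor factors. -/
lemma Bop_last {k ι : Type*} [Field k] [DecidableEq ι] (B : Matrix (ι × ι) (ι × ι) k)
    {N : ℕ} (c d : Fin N → ι) (n i q r : ι) :
    Bop B (N + 2) N (Fin.snoc (Fin.snoc c n : Fin (N + 1) → ι) i)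
      (Fin.snoc (Fin.snoc d q : Fin (N + 1) → ι) r) =
      B (n, i) (q, r) * if c = d then 1 else 0 := by
  rw [Bop_apply B (Nat.lt_succ_self _), Fin.prod_univ_castSucc, Fin.prod_univ_castSucc]
  have h1 : (⟨N, by omega⟩ : Fin (N + 2)) = Fin.castSucc (Fin.last N) := rfl
  have h2 : (⟨N + 1, by omega⟩ : Fin (N + 2)) = Fin.last (N + 1) := rfl
  have h3 (j : Fin N) : ¬ ((j : ℕ) = N ∨ (j : ℕ) = N + 1) := by omega
  simp only [h1, h2, Fin.snoc_castSucc, Fin.snoc_last, Fin.val_castSucc, Fin.val_last,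
    if_neg (h3 _), true_or, or_true, if_true, mul_one, Finset.prod_ite_zero,
    Finset.prod_const_one, funext_iff, Finset.mem_univ, true_implies]

variable {k : Type*} [Field k] {ι : Type*} [Fintype ι] [DecidableEq ι]

lemma extendLast_snoc {N : ℕ} (M : Matrix (Fin N → ι) (Fin N → ι) k) (c d : Fin N → ι) (i j : ι) :
    extendLast M (Fin.snoc c i) (Fin.snoc d j) = M c d * if i = j then 1 else 0 := by
  simp [extendLast]

lemma extendLast_one {N : ℕ} :
    extendLast (1 : Matrix (Fin N → ι) (Fin N → ι) k) = 1 := by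
  refine matrix_ext_snoc fun c i d j => ?_
  rw [extendLast_snoc, Matrix.one_apply, Matrix.one_apply]
  by_cases hc : c = d <;> by_cases hi : i = j <;> simp [hc, hi]

lemma extendLast_mul {N : ℕ} (M M' : Matrix (Fin N → ι) (Fin N → ι) k) :
    extendLast (M * M') = extendLast M * extendLast M' := by
  refine matrix_ext_snoc fun c i d j => ?_
  simp only [Matrix.mul_apply, sum_fun_eq_sum_snoc (N := N), extendLast_snoc, Finset.sum_mul]
  refine Finset.sum_congr rfl fun e _ => ?_
  rw [Finset.sum_eq_single i (fun b _ hb => by simp [hb.symm]) (by simp)]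
  simp

lemma extendLast_sum {N : ℕ} {α : Type*} (s : Finset α)
    (M : α → Matrix (Fin N → ι) (Fin N → ι) k) :
    extendLast (∑ a ∈ s, M a) = ∑ a ∈ s, extendLast (M a) := by
  refine matrix_ext_snoc fun c i d j => ?_
  simp only [Matrix.sum_apply, extendLast_snoc, Finset.sum_mul]

lemma extendLast_mulVec {N : ℕ} (M : Matrix (Fin N → ι) (Fin N → ι) k)
    (v : (Fin (N + 1) → ι) → k) (c : Fin N → ι) (i : ι) :
    (extendLast M *ᵥ v) (Fin.snoc c i) = (M *ᵥ fun d => v (Fin.snoc d i)) c := by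
  simp only [Matrix.mulVec, dotProduct, sum_fun_eq_sum_snoc (N := N), extendLast_snoc]
  refine Finset.sum_congr rfl fun e _ => ?_
  rw [Finset.sum_eq_single i (fun b _ hb => by simp [hb.symm]) (by simp)]
  simp

lemma extendLast_Bop (B : Matrix (ι × ι) (ι × ι) k) {N i : ℕ} (hi : i + 1 < N) :
    extendLast (Bop B N i) = Bop B (N + 1) i := by
  refine matrix_ext_snoc fun c a d b => ?_
  rw [extendLast_snoc, Bop_apply B hi, Bop_apply B (Nat.lt_succ_of_lt hi), Fin.prod_univ_castSucc]
  have h1 : (⟨i, by omega⟩ : Fin (N + 1)) = Fin.castSucc ⟨i, by omega⟩ := rfl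
  have h2 : (⟨i + 1, by omega⟩ : Fin (N + 1)) = Fin.castSucc ⟨i + 1, hi⟩ := rfl
  have h3 : ¬ (N = i ∨ N = i + 1) := by omega
  simp only [h1, h2, Fin.snoc_castSucc, Fin.snoc_last, Fin.val_castSucc, Fin.val_last,
    if_neg h3, mul_assoc]

lemma chainDesc_succ_left (B : Matrix (ι × ι) (ι × ι) k) (N m : ℕ) (hm : m ≤ N) :
    chainDesc B (N + 2) (m + 1) = Bop B (N + 2) N * extendLast (chainDesc B (N + 1) m) := by
  induction m with
  | zero => simp [chainDesc, extendLast_one]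
  | succ m ih =>
    rw [chainDesc, ih (by omega), chainDesc, extendLast_mul, extendLast_Bop B (by omega),
      Matrix.mul_assoc]
    congr 3
    omega

lemma braidedInt_succ (B : Matrix (ι × ι) (ι × ι) k) (N : ℕ) :
    braidedInt B (N + 2) = 1 + Bop B (N + 2) N * extendLast (braidedInt B (N + 1)) := by
  rw [braidedInt, Finset.sum_range_succ', braidedInt, extendLast_sum, Finset.mul_sum]
  refine (add_comm _ _).trans (congrArg (chainDesc B (N + 2) 0 + ·) ?_)
  exact Finset.sum_congr rfl fun m hm =>
    chainDesc_succ_left B N m (Nat.lt_succ_iff.mp (Finset.mem_range.mp hm))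

lemma braidedInt_one (B : Matrix (ι × ι) (ι × ι) k) : braidedInt B 1 = 1 := by
  simp [braidedInt, chainDesc]

lemma braidedInt_snoc (B : Matrix (ι × ι) (ι × ι) k) {N : ℕ} (c : Fin N → ι) (n i : ι)
    (a : Fin (N + 1) → ι) (r : ι) :
    braidedInt B (N + 2) (Fin.snoc (Fin.snoc c n : Fin (N + 1) → ι) i) (Fin.snoc a r) =
      (if (Fin.snoc c n : Fin (N + 1) → ι) = a ∧ i = r then 1 else 0) +
        ∑ q, B (n, i) (q, r) * braidedInt B (N + 1) (Fin.snoc c q) a := by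
  rw [braidedInt_succ, Matrix.add_apply, Matrix.one_apply, Matrix.mul_apply]
  congr 1
  · exact if_congr (snoc_eq_snoc_iff _ _ _ _) rfl rfl
  · simp only [sum_fun_eq_sum_snoc (N := N + 1), sum_fun_eq_sum_snoc (N := N), Bop_last,
      extendLast_snoc]
    rw [Finset.sum_eq_single c (fun b _ hb => by simp [hb.symm]) (by simp)]
    simp

end BraidedRecursion

section Skew

variable {k : Type*} [Field k] {ι : Type*} [Fintype ι]
variable {Rm : Matrix (ι × ι) (ι × ι) k}

/-- The braid matrix `B = P R`, with `P` the flip. -/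
def braidMatrix {k ι : Type*} (Rm : Matrix (ι × ι) (ι × ι) k) : Matrix (ι × ι) (ι × ι) k :=
  fun a b => Rm (a.2, a.1) b

/-- Contraction of the second tensor factor with an element of `Y₊`. -/
noncomputable def pairContract (p : Yplus k ι Rm →ₗ[k] Module.Dual k (Yminus k ι Rm))
    (x : Yplus k ι Rm) : Yminus k ι Rm ⊗[k] Yminus k ι Rm →ₗ[k] Yminus k ι Rm :=
  (TensorProduct.rid k (Yminus k ι Rm)).toLinearMap ∘ₗ (p x).lTensor (Yminus k ι Rm)

@[simp]
lemma pairContract_tmul (p : Yplus k ι Rm →ₗ[k] Module.Dual k (Yminus k ι Rm))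
    (x : Yplus k ι Rm) (a b : Yminus k ι Rm) :
    pairContract p x (a ⊗ₜ[k] b) = p x b • a := by
  simp [pairContract]

/-- The product `E_{a₁}⋯E_{a_N}`. -/
abbrev eProd (Rm : Matrix (ι × ι) (ι × ι) k) {N : ℕ} (a : Fin N → ι) : Yminus k ι Rm :=
  (List.ofFn fun s => eM k ι Rm (a s)).prod

/-- The product `F^{q₁}⋯F^{q_N}`. -/
abbrev fProd (Rm : Matrix (ι × ι) (ι × ι) k) {N : ℕ} (q : Fin N → ι) : Yplus k ι Rm :=
  (List.ofFn fun s => fP k ι Rm (q s)).prod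

lemma eProd_snoc {N : ℕ} (a : Fin N → ι) (r : ι) :
    eProd Rm (Fin.snoc a r : Fin (N + 1) → ι) = eProd Rm a * eM k ι Rm r := by
  rw [eProd, List.ofFn_succ']
  simp [-List.ofFn_succ]

lemma fProd_snoc {N : ℕ} (q : Fin N → ι) (r : ι) :
    fProd Rm (Fin.snoc q r : Fin (N + 1) → ι) = fProd Rm q * fP k ι Rm r := by
  rw [fProd, List.ofFn_succ']
  simp [-List.ofFn_succ]

lemma fP_mul_uP (i j m : ι) : fP k ι Rm j * uP k ι Rm i m =
    ∑ s : ι, ∑ q : ι, Rm (i, j) (s, q) • (uP k ι Rm s m * fP k ι Rm q) := by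
  have := RingQuot.mkAlgHom_rel k (relPlus.rfu (k := k) (Rm := Rm) i j m)
  simpa [fP, uP] using this

/-- The left ideal of `Y₊` generated by the products `F^{q₁}⋯F^{q_N}`. -/
noncomputable def fIdeal (Rm : Matrix (ι × ι) (ι × ι) k) (N : ℕ) : Ideal (Yplus k ι Rm) :=
  Ideal.span (Set.range fun q : Fin N → ι => fProd Rm q)

lemma fProd_mem_fIdeal {N : ℕ} (q : Fin N → ι) : fProd Rm q ∈ fIdeal Rm N :=
  Ideal.subset_span ⟨q, rfl⟩

lemma smul_mem_ideal {A : Type*} [Ring A] [Algebra k A] (I : Ideal A) (r : k) {x : A}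
    (hx : x ∈ I) : r • x ∈ I := by
  rw [Algebra.smul_def]
  exact I.mul_mem_left _ hx

lemma mul_fP_mem_fIdeal {N : ℕ} {x : Yplus k ι Rm} (hx : x ∈ fIdeal Rm N) (r : ι) :
    x * fP k ι Rm r ∈ fIdeal Rm (N + 1) := by
  induction hx using Submodule.span_induction with
  | mem x h =>
    obtain ⟨q, rfl⟩ := h
    simp only [← fProd_snoc]
    exact fProd_mem_fIdeal _
  | zero => simp
  | add x y _ _ hx hy => rw [add_mul]; exact add_mem hx hy
  | smul y x _ hx => rw [smul_eq_mul, mul_assoc]; exact Ideal.mul_mem_left _ _ hx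

lemma fProd_mul_uP_mem_fIdeal {N : ℕ} (q : Fin N → ι) (i m : ι) :
    fProd Rm q * uP k ι Rm i m ∈ fIdeal Rm N := by
  induction N generalizing i with
  | zero =>
    have h : (1 : Yplus k ι Rm) ∈ fIdeal Rm 0 := by
      simpa [fProd] using fProd_mem_fIdeal (Rm := Rm) q
    exact (Ideal.eq_top_iff_one _).mpr h ▸ Submodule.mem_top
  | succ N ih =>
    rw [← Fin.snoc_init_self q, fProd_snoc, mul_assoc, fP_mul_uP]
    simp only [Finset.mul_sum, mul_smul_comm, ← mul_assoc]
    exact sum_mem fun s _ => sum_mem fun t _ =>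
      smul_mem_ideal _ _ (mul_fP_mem_fIdeal (ih _ s) t)

lemma mul_uP_mem_fIdeal {N : ℕ} {x : Yplus k ι Rm} (hx : x ∈ fIdeal Rm N) (i m : ι) :
    x * uP k ι Rm i m ∈ fIdeal Rm N := by
  induction hx using Submodule.span_induction with
  | mem x h =>
    obtain ⟨q, rfl⟩ := h
    exact fProd_mul_uP_mem_fIdeal q i m
  | zero => simp
  | add x y _ _ hx hy => rw [add_mul]; exact add_mem hx hy
  | smul y x _ hx => rw [smul_eq_mul, mul_assoc]; exact Ideal.mul_mem_left _ _ hx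

lemma mul_mem_fIdeal {N : ℕ} {x Φ : Yplus k ι Rm} (hx : x ∈ fIdeal Rm N)
    (hΦ : Φ ∈ Algebra.adjoin k (Set.range fun x : ι × ι => uP k ι Rm x.1 x.2)) :
    x * Φ ∈ fIdeal Rm N := by
  induction hΦ using Algebra.adjoin_induction generalizing x with
  | mem Φ h =>
    obtain ⟨⟨i, m⟩, rfl⟩ := h
    exact mul_uP_mem_fIdeal hx i m
  | algebraMap r =>
    rw [← Algebra.commutes, ← Algebra.smul_def]
    exact smul_mem_ideal _ _ hx
  | add Φ Ψ _ _ h h' => rw [mul_add]; exact add_mem (h hx) (h' hx)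
  | mul Φ Ψ _ _ h h' => rw [← mul_assoc]; exact h' (h hx)

variable [DecidableEq ι]
variable {p : Yplus k ι Rm →ₗ[k] Module.Dual k (Yminus k ι Rm)}
  {Dm : Yminus k ι Rm →ₐ[k] (Yminus k ι Rm ⊗[k] Yminus k ι Rm)}
  {Dp : Yplus k ι Rm →ₐ[k] (Yplus k ι Rm ⊗[k] Yplus k ι Rm)}

namespace IsYBPairing

lemma apply_mul (hp : IsYBPairing Rm p Dm Dp) (x y : Yplus k ι Rm) (a : Yminus k ι Rm) :
    p (x * y) a = p x (pairContract p y (Dm a)) := by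
  rw [hp.skew_mul]
  induction Dm a with
  | zero => simp
  | tmul b c => simp [tensorPairing, mul_comm]
  | add S T hS hT => simp only [map_add, hS, hT]

lemma one_mul_apply (hp : IsYBPairing Rm p Dm Dp) (a b : Yminus k ι Rm) :
    p 1 (b * a) = p 1 b * p 1 a := by
  rw [← hp.skew_comul, map_one, Algebra.TensorProduct.one_def]
  simp [tensorPairing, mul_comm]

lemma fP_apply_mul (hp : IsYBPairing Rm p Dm Dp) (i : ι) (a b : Yminus k ι Rm) :
    p (fP k ι Rm i) (b * a) = p 1 b * p (fP k ι Rm i) a +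
      ∑ q, p (fP k ι Rm q) b * p (uP k ι Rm i q) a := by
  rw [← hp.skew_comul, hp.comul_f]
  simp [tensorPairing, mul_comm]

lemma pairContract_one_mul (hp : IsYBPairing Rm p Dm Dp)
    (S T : Yminus k ι Rm ⊗[k] Yminus k ι Rm) :
    pairContract p 1 (S * T) = pairContract p 1 S * pairContract p 1 T := by
  induction S with
  | zero => simp
  | add S S' hS hS' => simp only [add_mul, map_add, hS, hS']
  | tmul b c =>
    induction T with
    | zero => simp
    | add T T' hT hT' => simp only [mul_add, map_add, hT, hT']
    | tmul d e => simp [hp.one_mul_apply, smul_smul, mul_comm]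

lemma pairContract_fP_mul (hp : IsYBPairing Rm p Dm Dp) (i : ι)
    (S T : Yminus k ι Rm ⊗[k] Yminus k ι Rm) :
    pairContract p (fP k ι Rm i) (S * T) =
      pairContract p 1 S * pairContract p (fP k ι Rm i) T +
        ∑ q, pairContract p (fP k ι Rm q) S * pairContract p (uP k ι Rm i q) T := by
  induction S with
  | zero => simp
  | add S S' hS hS' =>
    simp only [add_mul, map_add, hS, hS', Finset.sum_add_distrib]
    abel
  | tmul b c =>
    induction T with
    | zero => simp
    | add T T' hT hT' =>
      simp only [mul_add, map_add, hT, hT', Finset.sum_add_distrib]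
      abel
    | tmul d e =>
      simp [hp.fP_apply_mul, smul_smul, add_smul, Finset.sum_smul, mul_comm]

lemma pairContract_one_eM (hp : IsYBPairing Rm p Dm Dp) (m : ι) :
    pairContract p 1 (Dm (eM k ι Rm m)) = eM k ι Rm m := by
  simp [hp.comul_e, hp.pair_one_t, hp.pair_one_e]

lemma pairContract_fP_eM (hp : IsYBPairing Rm p Dm Dp) (i m : ι) :
    pairContract p (fP k ι Rm i) (Dm (eM k ι Rm m)) = if i = m then 1 else 0 := by
  simp [hp.comul_e, hp.pair_ft, hp.pair_fe]

lemma pairContract_uP_eM (hp : IsYBPairing Rm p Dm Dp) (i q m : ι) :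
    pairContract p (uP k ι Rm i q) (Dm (eM k ι Rm m)) =
      ∑ n, Rm (i, n) (q, m) • eM k ι Rm n := by
  simp [hp.comul_e, hp.pair_ut, hp.pair_ue]

lemma pairContract_one_eProd (hp : IsYBPairing Rm p Dm Dp) {N : ℕ} (a : Fin N → ι) :
    pairContract p 1 (Dm (eProd Rm a)) = eProd Rm a := by
  induction N with
  | zero => simp [eProd, Algebra.TensorProduct.one_def, hp.pair_one_one]
  | succ N ih =>
    rw [← Fin.snoc_init_self a, eProd_snoc, map_mul, hp.pairContract_one_mul, ih,
      hp.pairContract_one_eM]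

lemma pairContract_fP_eProd_snoc (hp : IsYBPairing Rm p Dm Dp) {N : ℕ} (i r : ι)
    (a : Fin N → ι) :
    pairContract p (fP k ι Rm i) (Dm (eProd Rm (Fin.snoc a r : Fin (N + 1) → ι))) =
      (if i = r then eProd Rm a else 0) +
        ∑ q, ∑ n, Rm (i, n) (q, r) •
          (pairContract p (fP k ι Rm q) (Dm (eProd Rm a)) * eM k ι Rm n) := by
  rw [eProd_snoc, map_mul, hp.pairContract_fP_mul, hp.pairContract_one_eProd,
    hp.pairContract_fP_eM]
  simp [hp.pairContract_uP_eM, Finset.mul_sum]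

/-- Contracting `E_{a₁}⋯E_{a_{N+1}}` with `F^i` on the right acts by the braided integer. -/
lemma pairContract_fP_eProd (hp : IsYBPairing Rm p Dm Dp) {N : ℕ} (i : ι)
    (a : Fin (N + 1) → ι) :
    pairContract p (fP k ι Rm i) (Dm (eProd Rm a)) =
      ∑ c : Fin N → ι,
        braidedInt (braidMatrix Rm) (N + 1) (Fin.snoc c i) a • eProd Rm c := by
  induction N generalizing i with
  | zero =>
    rw [← Fin.snoc_init_self a, hp.pairContract_fP_eProd_snoc,
      show braidedInt (braidMatrix Rm) (0 + 1) = 1 from braidedInt_one _]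
    simp only [Matrix.one_apply, snoc_eq_snoc_iff]
    rw [Finset.sum_eq_single (Fin.init a) (fun b _ hb => by simp [hb]) (fun h => absurd (Finset.mem_univ _) h)]
    simp [eProd, Algebra.TensorProduct.one_def, hp.pair_f_one]
  | succ N ih =>
    rw [← Fin.snoc_init_self a, hp.pairContract_fP_eProd_snoc]
    simp only [ih, sum_fun_eq_sum_snoc (N := N), braidedInt_snoc, add_smul,
      Finset.sum_add_distrib]
    congr 1
    · rw [← sum_fun_eq_sum_snoc
        (fun c => (if c = Fin.init a ∧ i = a (Fin.last _) then (1 : k) else 0) • eProd Rm c)]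
      rw [Finset.sum_eq_single (Fin.init a) (fun b _ hb => by simp [hb]) (by simp)]
      simp
    · simp only [Finset.sum_mul, Finset.smul_sum, Finset.sum_smul, eProd_snoc, smul_mul_assoc,
        smul_smul]
      rw [Finset.sum_comm_cycle]
      exact Finset.sum_congr rfl fun c _ => Finset.sum_comm

/-- `⟨y F^{q₁}⋯F^{q_N}, E_{a₁}⋯E_{a_N} ω^{a₁⋯a_N}⟩ = ⟨y, 1⟩ ([N!]_B ω)^{q₁⋯q_N}`. -/
theorem mul_fProd_apply (hp : IsYBPairing Rm p Dm Dp) {N : ℕ} (y : Yplus k ι Rm)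
    (q : Fin N → ι) (ω : (Fin N → ι) → k) :
    p (y * fProd Rm q) (∑ a, ω a • eProd Rm a) =
      p y 1 * (braidedFactorial (braidMatrix Rm) N *ᵥ ω) q := by
  induction N with
  | zero =>
    simp [fProd, eProd, braidedFactorial, mul_comm, Subsingleton.elim q default]
  | succ N ih =>
    have key : pairContract p (fP k ι Rm (q (Fin.last N))) (Dm (∑ a, ω a • eProd Rm a)) =
        ∑ c : Fin N → ι, (braidedInt (braidMatrix Rm) (N + 1) *ᵥ ω)
          (Fin.snoc c (q (Fin.last N))) • eProd Rm c := by
      simp only [map_sum, map_smul, hp.pairContract_fP_eProd, Finset.smul_sum, smul_smul,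
        Matrix.mulVec, dotProduct, Finset.sum_smul]
      rw [Finset.sum_comm]
      simp only [mul_comm]
    conv_lhs => rw [← Fin.snoc_init_self q, fProd_snoc, ← mul_assoc, hp.apply_mul, key, ih]
    conv_rhs => rw [braidedFactorial.eq_2, ← Matrix.mulVec_mulVec, ← Fin.snoc_init_self q,
      extendLast_mulVec]

end IsYBPairing

end Skew

/-- in the skew-paired Yang-Baxter bialgebras, an element
`E_{a₁}⋯E_{a_N} ω^{a₁⋯a_N}` of `Y₋` pairs to zero with every element
`F^{q₁}⋯F^{q_N} Φ(U)` of `Y₊` if and only if `[N!]_B ω = 0`. -/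
theorem stmt14 {k : Type*} [Field k] {ι : Type*} [Fintype ι] [DecidableEq ι]
    (Rm : Matrix (ι × ι) (ι × ι) k) (hinv : IsUnit Rm)
    (hYB : IsYangBaxter k ι Rm)
    (p : Yplus k ι Rm →ₗ[k] Module.Dual k (Yminus k ι Rm))
    (Dm : Yminus k ι Rm →ₐ[k] (Yminus k ι Rm ⊗[k] Yminus k ι Rm))
    (Dp : Yplus k ι Rm →ₐ[k] (Yplus k ι Rm ⊗[k] Yplus k ι Rm))
    (hp : IsYBPairing Rm p Dm Dp)
    (B : Matrix (ι × ι) (ι × ι) k) (hB : B = fun a b => Rm (a.2, a.1) b) :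
    ∀ (N : ℕ) (ω : (Fin N → ι) → k),
      (∀ (q : Fin N → ι) (Φ : Yplus k ι Rm),
        Φ ∈ Algebra.adjoin k (Set.range fun x : ι × ι => uP k ι Rm x.1 x.2) →
        p ((List.ofFn fun s => fP k ι Rm (q s)).prod * Φ)
            (∑ a : Fin N → ι, ω a • (List.ofFn fun s => eM k ι Rm (a s)).prod) = 0) ↔
      braidedFactorial B N *ᵥ ω = 0 := by
  obtain rfl : B = braidMatrix Rm := hB
  intro N ω
  constructor
  · intro h
    ext q
    have hq := hp.mul_fProd_apply 1 q ω
    rw [hp.pair_one_one, one_mul, one_mul] at hq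
    rw [← hq, Pi.zero_apply]
    simpa using h q 1 (one_mem _)
  · intro h q Φ hΦ
    have hmem := mul_mem_fIdeal (fProd_mem_fIdeal (Rm := Rm) q) hΦ
    obtain ⟨c, hc⟩ := (Submodule.mem_span_range_iff_exists_fun _).mp hmem
    change p (fProd Rm q * Φ) (∑ a, ω a • eProd Rm a) = 0
    rw [← hc, map_sum p, LinearMap.sum_apply]
    refine Finset.sum_eq_zero fun d _ => ?_
    rw [smul_eq_mul, hp.mul_fProd_apply, h, Pi.zero_apply, mul_zero]
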